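/- Let (X,d) be a metric space, μ a Borel probability measure on X, and T: X → X a Borel measurable map preserving μ. Then for every β > 0 and μ-almost every x ∈ X, liminf_{n→∞} n·d(T^n x, x)^β ≤ limsup_{r→0} H_β(B(x,r))/μ(B(x,r)), where H_β is the β-dimensional Hausdorff outer measure. -/

import Mathlib

open MeasureTheory Filter Metric
open scoped ENNReal NNReal Topology

section Recurrence

variable {X : Type*} [MeasurableSpace X] {μ : Measure X} {T : X → X}

lemma mul_card_le_of_separated {c g : ℝ≥0∞} (S : Finset ℕ)
    (h : ∀ i ∈ S, ∀ j ∈ S, i < j → c ≤ ((j - i : ℕ) : ℝ≥0∞) * g) (m : ℕ) (hm : ∀ i ∈ S, i ≤ m) :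
    c * S.card ≤ c + m * g := by
  induction S using Finset.induction_on_max generalizing m with
  | empty => simp
  | insert a s ha ih =>
    have hcard : (insert a s).card = s.card + 1 :=
      Finset.card_insert_of_notMem fun h' => (ha a h').false
    rcases s.eq_empty_or_nonempty with rfl | hs
    · simp
    · have hb : s.max' hs < a := ha _ (s.max'_mem hs)
      have h1 := ih (fun i hi j hj => h i (Finset.mem_insert_of_mem hi) j
        (Finset.mem_insert_of_mem hj)) (s.max' hs) fun i hi => s.le_max' i hi
      have h2 := h _ (Finset.mem_insert_of_mem (s.max'_mem hs)) a (Finset.mem_insert_self a s) hb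
      have h3 : (a : ℝ≥0∞) ≤ m := by exact_mod_cast hm a (Finset.mem_insert_self a s)
      calc c * ((insert a s).card : ℝ≥0∞) = c * s.card + c := by
            rw [hcard]; push_cast; ring
        _ ≤ c + (s.max' hs : ℝ≥0∞) * g + ((a - s.max' hs : ℕ) : ℝ≥0∞) * g := add_le_add h1 h2
        _ = c + ((s.max' hs + (a - s.max' hs) : ℕ) : ℝ≥0∞) * g := by push_cast; ring
        _ = c + a * g := by rw [Nat.add_sub_cancel' hb.le]
        _ ≤ c + m * g := by gcongr

/-- If the visits of almost every orbit to `V` are separated by gaps of length at least `c / g`,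
then `V` has measure at most `(∫ g) / c`. -/
lemma mul_measure_le_lintegral_of_separated_visits (hT : MeasurePreserving T μ μ) {V : Set X}
    [IsFiniteMeasure μ]
    (hV : MeasurableSet V) {c : ℝ≥0∞} (hc : c ≠ ∞) {g : X → ℝ≥0∞} (hg : Measurable g)
    (h : ∀ᵐ x ∂μ, ∀ i j : ℕ, i < j → T^[i] x ∈ V → T^[j] x ∈ V →
      c ≤ ((j - i : ℕ) : ℝ≥0∞) * g x) :
    c * μ V ≤ ∫⁻ x, g x ∂μ := by
  classical
  have key : ∀ N : ℕ, N * (c * μ V) ≤ c * μ Set.univ + N * ∫⁻ x, g x ∂μ := by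
    intro N
    calc N * (c * μ V)
        = ∫⁻ x, c * ∑ j ∈ Finset.range N, V.indicator 1 (T^[j] x) ∂μ := by
          have hm : ∀ j ∈ Finset.range N,
              Measurable fun x => V.indicator (1 : X → ℝ≥0∞) (T^[j] x) := fun j _ =>
            (measurable_one.indicator hV).comp (hT.iterate j).measurable
          rw [lintegral_const_mul _ (Finset.measurable_fun_sum _ hm), lintegral_finsetSum _ hm]
          have : ∀ j ∈ Finset.range N, ∫⁻ x, V.indicator 1 (T^[j] x) ∂μ = μ V := fun j _ => by
            rw [(hT.iterate j).lintegral_comp (measurable_one.indicator hV),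
              lintegral_indicator_one hV]
          rw [Finset.sum_congr rfl this]
          simp only [Finset.sum_const, Finset.card_range, nsmul_eq_mul]
          ring
      _ ≤ ∫⁻ x, (c + N * g x) ∂μ := by
          refine lintegral_mono_ae ?_
          filter_upwards [h] with x hx
          have e : ∑ j ∈ Finset.range N, V.indicator (1 : X → ℝ≥0∞) (T^[j] x)
              = ((Finset.range N).filter fun j => T^[j] x ∈ V).card := by
            simp [Set.indicator_apply, Finset.sum_boole]
          rw [e]
          refine mul_card_le_of_separated _ (fun i hi j hj hij => ?_) N fun i hi => ?_
          · exact hx i j hij (Finset.mem_filter.1 hi).2 (Finset.mem_filter.1 hj).2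
          · exact (Finset.mem_range.1 (Finset.mem_filter.1 hi).1).le
      _ = c * μ Set.univ + N * ∫⁻ x, g x ∂μ := by
          rw [lintegral_add_left measurable_const, lintegral_const, lintegral_const_mul _ hg]
  have key2 : ∀ᶠ N : ℕ in atTop, c * μ V ≤ c * μ Set.univ / N + ∫⁻ x, g x ∂μ := by
    filter_upwards [eventually_gt_atTop 0] with N hN
    have hN0 : (N : ℝ≥0∞) ≠ 0 := by exact_mod_cast hN.ne'
    have hNt : (N : ℝ≥0∞) ≠ ∞ := ENNReal.natCast_ne_top N
    have := ENNReal.div_le_div_right (key N) N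
    have e : ∀ y : ℝ≥0∞, N * y / N = y := fun y => by
      rw [mul_comm, ENNReal.mul_div_cancel_right hN0 hNt]
    rwa [ENNReal.add_div, e, e] at this
  refine ge_of_tendsto ?_ key2
  have h0 : Tendsto (fun N : ℕ => c * μ Set.univ / N) atTop (𝓝 0) :=
    ENNReal.Tendsto.const_div ENNReal.tendsto_nat_nhds_top
      (Or.inr (ENNReal.mul_ne_top hc (measure_ne_top _ _))) |>.trans (by simp)
  simpa using h0.add_const (∫⁻ x, g x ∂μ)

end Recurrence

section Hausdorff

variable {X : Type*} [MetricSpace X] [MeasurableSpace X] [BorelSpace X] {β : ℝ}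

lemma exists_cover_of_hausdorffMeasure_lt (hβ : 0 < β) {s : Set X} {b : ℝ≥0∞}
    (h : μH[β] s < b) {r : ℝ≥0∞} (hr : 0 < r) :
    ∃ t : ℕ → Set X, s ⊆ ⋃ n, t n ∧ (∀ n, ediam (t n) ≤ r) ∧ ∑' n, ediam (t n) ^ β < b := by
  rw [Measure.hausdorffMeasure_apply] at h
  have h1 := (le_iSup₂ (f := fun (r : ℝ≥0∞) (_ : 0 < r) =>
    ⨅ (t : ℕ → Set X) (_ : s ⊆ ⋃ n, t n) (_ : ∀ n, ediam (t n) ≤ r),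
          ∑' n, ⨆ _ : (t n).Nonempty, ediam (t n) ^ β) r hr).trans_lt h
  simp only [iInf_lt_iff] at h1
  obtain ⟨t, hst, htr, hlt⟩ := h1
  refine ⟨t, hst, htr, lt_of_le_of_lt (ENNReal.tsum_le_tsum fun n => ?_) hlt⟩
  rcases (t n).eq_empty_or_nonempty with h0 | h0
  · simp [h0, hβ]
  · exact le_iSup (fun _ : (t n).Nonempty => ediam (t n) ^ β) h0

lemma isSeparable_of_hausdorffMeasure_ne_top (hβ : 0 < β) {s : Set X} (h : μH[β] s ≠ ∞) :
    TopologicalSpace.IsSeparable s := by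
  have := EMetric.subset_countable_closure_of_almost_dense_set s fun ε hε => ?_
  · obtain ⟨t, -, htc, hst⟩ := this
    exact ⟨t, htc, hst⟩
  classical
  obtain ⟨t, hst, htr, -⟩ := exists_cover_of_hausdorffMeasure_lt hβ h.lt_top hε
  rcases s.eq_empty_or_nonempty with rfl | ⟨x₀, -⟩
  · exact ⟨∅, Set.countable_empty, Set.empty_subset _⟩
  let p : ℕ → X := fun n => if hn : (t n).Nonempty then hn.some else x₀
  refine ⟨Set.range p, Set.countable_range p, fun x hx => ?_⟩
  obtain ⟨n, hn⟩ := Set.mem_iUnion.1 (hst hx)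
  refine Set.mem_biUnion (Set.mem_range_self n) ?_
  have hne : (t n).Nonempty := ⟨x, hn⟩
  have : p n ∈ t n := by simp only [p, dif_pos hne]; exact hne.some_mem
  exact (edist_le_ediam_of_mem hn this).trans (htr n)

end Hausdorff

/-- An `ε`-neighbourhood of a separable set is a countable union of `ε`-balls centred in it. -/
lemma exists_countable_biUnion_ball {X : Type*} [MetricSpace X] {s : Set X} (hs : TopologicalSpace.IsSeparable s) (ε : ℝ) :
    ∃ q ⊆ s, q.Countable ∧ ⋃ x ∈ s, ball x ε = ⋃ x ∈ q, ball x ε := by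
  obtain ⟨q, hqs, hqc, hq⟩ := hs.exists_countable_dense_subset
  refine ⟨q, hqs, hqc, Set.Subset.antisymm (fun z hz => ?_)
    (Set.biUnion_subset_biUnion_left hqs)⟩
  obtain ⟨x, hx, hzx⟩ := Set.mem_iUnion₂.1 hz
  rw [mem_ball] at hzx
  obtain ⟨y, hy, hxy⟩ := Metric.mem_closure_iff.1 (hq hx) (ε - dist z x) (by linarith)
  refine Set.mem_biUnion hy ?_
  rw [mem_ball]
  linarith [dist_triangle z x y]

section Density

variable {X : Type*} [MetricSpace X] [MeasurableSpace X] [BorelSpace X] {β : ℝ}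

/-- A Vitali covering lemma for closed balls centred in a separable open subset of a possibly
non-separable metric space. -/
lemma exists_disjoint_closedBall_covering (ν : Measure X) [IsFiniteMeasure ν] {P G : Set X}
    (hP : IsOpen P) (hPs : TopologicalSpace.IsSeparable P) (hG : G ⊆ P) (C : ℝ≥0)
    (p : X → ℝ → Prop)
    (h : ∀ x ∈ G, ∀ ε > 0, ∃ r, 0 < r ∧ r ≤ ε ∧ p x r ∧
      ν (closedBall x (3 * r)) ≤ C * ν (closedBall x r)) :
    ∃ u : Set (X × ℝ), u.Countable ∧ (∀ a ∈ u, a.1 ∈ G ∧ p a.1 a.2) ∧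
      u.PairwiseDisjoint (fun a => closedBall a.1 a.2) ∧
      ν (G \ ⋃ a ∈ u, closedBall a.1 a.2) = 0 := by
  have : SecondCountableTopology P := by
    have := hPs.separableSpace
    exact UniformSpace.secondCountable_of_separable P
  have hval : MeasurableEmbedding ((↑) : P → X) := MeasurableEmbedding.subtype_coe hP.measurableSet
  have himage : ∀ (x : P) (r : ℝ), closedBall (x : X) r ⊆ P →
      ((↑) : P → X) '' closedBall x r = closedBall (x : X) r := by
    intro x r hx
    ext z
    simp only [Set.mem_image, mem_closedBall, Subtype.exists, exists_and_right, exists_eq_right]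
    exact ⟨fun ⟨_, h⟩ => h, fun h => ⟨hx h, h⟩⟩
  have hsub : ∀ (x : P) (r : ℝ), 0 ≤ r → closedBall (x : X) (3 * r) ⊆ P →
      closedBall (x : X) r ⊆ P := fun x r hr hx =>
    (closedBall_subset_closedBall (by linarith)).trans hx
  obtain ⟨u, hut, huc, hud, hu⟩ := Vitali.exists_disjoint_covering_ae (ν.comap ((↑) : P → X))
    (((↑) : P → X) ⁻¹' G)
    {a : P × ℝ | (a.1 : X) ∈ G ∧ 0 < a.2 ∧ p a.1 a.2 ∧ closedBall (a.1 : X) (3 * a.2) ⊆ P ∧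
      ν (closedBall (a.1 : X) (3 * a.2)) ≤ C * ν (closedBall (a.1 : X) a.2)} C Prod.snd Prod.fst
    (fun a => closedBall a.1 a.2) (fun a _ => subset_rfl)
    (fun a ⟨_, h0, _, h3, h4⟩ => by
      rwa [hval.comap_apply, hval.comap_apply, himage _ _ h3, himage _ _ (hsub _ _ h0.le h3)])
    (fun a ⟨_, h0, _⟩ => ⟨a.1, ball_subset_interior_closedBall (mem_ball_self h0)⟩)
    (fun a _ => isClosed_closedBall)
    (fun x hx ε hε => by
      obtain ⟨δ, hδ, hδP⟩ := Metric.isOpen_iff.1 hP x x.2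
      obtain ⟨r, hr, hrε, hpr, hνr⟩ := h x hx (min ε (δ / 4)) (by positivity)
      have h1 := hrε.trans (min_le_left _ _)
      have h2 := hrε.trans (min_le_right _ _)
      exact ⟨(x, r), ⟨hx, hr, hpr, (closedBall_subset_ball (by linarith)).trans hδP, hνr⟩, h1, rfl⟩)
  have hcb : ∀ a ∈ u, ((↑) : P → X) '' closedBall a.1 a.2 = closedBall (a.1 : X) a.2 := fun a ha =>
    himage _ _ (hsub _ _ (hut ha).2.1.le (hut ha).2.2.2.1)
  refine ⟨(fun a : P × ℝ => ((a.1 : X), a.2)) '' u, huc.image _, ?_, ?_, ?_⟩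
  · rintro _ ⟨a, ha, rfl⟩
    exact ⟨(hut ha).1, (hut ha).2.2.1⟩
  · rintro _ ⟨a, ha, rfl⟩ _ ⟨b, hb, rfl⟩ hab
    have hab' : a ≠ b := fun h => hab (by rw [h])
    have := hud ha hb hab'
    simp only [Function.onFun] at this ⊢
    rw [← hcb a ha, ← hcb b hb]
    exact Set.disjoint_image_of_injective Subtype.val_injective this
  · rw [hval.comap_apply] at hu
    refine measure_mono_null ?_ hu
    rintro z ⟨hzG, hz⟩
    refine ⟨⟨z, hG hzG⟩, ⟨hzG, fun hz' => hz ?_⟩, rfl⟩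
    obtain ⟨a, ha, hza⟩ := Set.mem_iUnion₂.1 hz'
    exact Set.mem_biUnion (Set.mem_image_of_mem _ ha) hza

lemma mul_measure_inter_le_hausdorffMeasure (hβ : 0 < β) {μ : Measure X} {A : Set X}
    {c η : ℝ≥0∞} (hη : 0 < η)
    (hA : ∀ U : Set X, ediam U ≤ η → c * μ (A ∩ U) ≤ ediam U ^ β) (B : Set X) :
    c * μ (A ∩ B) ≤ μH[β] B := by
  refine le_of_forall_gt fun b hb => ?_
  obtain ⟨t, hBt, htη, hlt⟩ := exists_cover_of_hausdorffMeasure_lt hβ hb hη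
  refine lt_of_le_of_lt ?_ hlt
  calc c * μ (A ∩ B) ≤ c * ∑' n, μ (A ∩ t n) := by
        gcongr
        refine (measure_mono ?_).trans (measure_iUnion_le _)
        rw [← Set.inter_iUnion]
        exact Set.inter_subset_inter_right _ hBt
    _ = ∑' n, c * μ (A ∩ t n) := ENNReal.tsum_mul_left.symm
    _ ≤ ∑' n, ediam (t n) ^ β := ENNReal.tsum_le_tsum fun n => hA _ (htη n)

lemma measure_le_of_forall_closedBall_le (hβ : 0 < β) {μ : Measure X} {A E : Set X}
    {c η κ : ℝ≥0∞} (hη : 0 < η) (hc : c ≠ 0)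
    (hA : ∀ U : Set X, ediam U ≤ η → c * μ (A ∩ U) ≤ ediam U ^ β) (hEA : E ⊆ A)
    {s : ℝ} (hs : 0 < s)
    (hE : ∀ x ∈ E, ∀ r, 0 < r → r ≤ s → μ (A ∩ closedBall x r) ≤ κ * ENNReal.ofReal r ^ β)
    {b : ℝ≥0∞} (hb : μH[β] E < b) : μ E ≤ κ * b := by
  obtain ⟨t, hEt, htη, hlt⟩ := exists_cover_of_hausdorffMeasure_lt hβ hb
    (r := min η (ENNReal.ofReal s)) (by simp [hη, hs])
  have key : ∀ n, μ (E ∩ t n) ≤ κ * ediam (t n) ^ β := by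
    intro n
    rcases (E ∩ t n).eq_empty_or_nonempty with h0 | ⟨x, hxE, hxt⟩
    · simp [h0]
    have hle : μ (E ∩ t n) ≤ μ (A ∩ t n) := measure_mono (Set.inter_subset_inter_left _ hEA)
    have hη' := (htη n).trans (min_le_left _ _)
    have hs' := (htη n).trans (min_le_right _ _)
    rcases eq_or_ne (ediam (t n)) 0 with hd | hd
    · have := hA _ hη'
      rw [hd, ENNReal.zero_rpow_of_pos hβ, nonpos_iff_eq_zero, mul_eq_zero] at this
      rw [this.resolve_left hc] at hle
      exact hle.trans zero_le
    · have hdt : ediam (t n) ≠ ∞ := (hs'.trans_lt ENNReal.ofReal_lt_top).ne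
      have h1 := hE x hxE (ediam (t n)).toReal (ENNReal.toReal_pos hd hdt)
        (ENNReal.toReal_le_of_le_ofReal hs.le hs')
      rw [ENNReal.ofReal_toReal hdt] at h1
      refine (hle.trans (measure_mono (Set.inter_subset_inter_right _ fun y hy => ?_))).trans h1
      rw [mem_closedBall, dist_edist]
      exact ENNReal.toReal_mono hdt (edist_le_ediam_of_mem hy hxt)
  calc μ E ≤ ∑' n, μ (E ∩ t n) := by
        refine (measure_mono ?_).trans (measure_iUnion_le _)
        rw [← Set.inter_iUnion]
        exact Set.subset_inter subset_rfl hEt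
    _ ≤ ∑' n, κ * ediam (t n) ^ β := ENNReal.tsum_le_tsum key
    _ = κ * ∑' n, ediam (t n) ^ β := ENNReal.tsum_mul_left
    _ ≤ κ * b := by gcongr

lemma hausdorffMeasure_closedBall_le {μ : Measure X} [IsFiniteMeasure μ] {c' : ℝ≥0∞}
    (hc' : c' ≠ ∞) {x : X} {r r₀ : ℝ} (hr : r < r₀) (hr0 : 0 < r)
    (h : ∀ r, 0 < r → r < r₀ → μH[β] (ball x r) ≤ c' * μ (ball x r)) :
    μH[β] (closedBall x r) ≤ c' * μ (closedBall x r) := by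
  obtain ⟨v, hv, hvr, hvt⟩ := exists_seq_strictAnti_tendsto' hr
  have hbi : ⋂ n, ball x (v n) = closedBall x r := by
    ext y
    simp only [Set.mem_iInter, mem_ball, mem_closedBall]
    refine ⟨fun h => ge_of_tendsto' hvt fun n => (h n).le, fun h n => h.trans_lt (hvr n).1⟩
  have ht : Tendsto (fun n => c' * μ (ball x (v n))) atTop (𝓝 (c' * μ (closedBall x r))) := by
    refine ENNReal.Tendsto.const_mul ?_ (Or.inr hc')
    rw [← hbi]
    exact tendsto_measure_iInter_atTop (fun n => isOpen_ball.measurableSet.nullMeasurableSet)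
      (fun m n hmn => ball_subset_ball (hv.antitone hmn)) ⟨0, measure_ne_top _ _⟩
  refine ge_of_tendsto' ht fun n => ?_
  exact (measure_mono (closedBall_subset_ball (hvr n).1)).trans
    (h _ (hr0.trans (hvr n).1) (hvr n).2)

lemma measure_eq_zero_of_closedBall_large (hβ : 0 < β) {μ : Measure X} [IsFiniteMeasure μ]
    {A P G : Set X} {c c' η κ : ℝ≥0∞} (hη : 0 < η) (hc : c ≠ ∞) (hcc : c' < c) (hκ : κ ≠ 0)
    (hAm : MeasurableSet A)
    (hA : ∀ U : Set X, ediam U ≤ η → c * μ (A ∩ U) ≤ ediam U ^ β)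
    (hP : IsOpen P) (hPs : TopologicalSpace.IsSeparable P) (hGP : G ⊆ P) (hGA : G ⊆ A)
    {r₀ : ℝ} (hr₀ : 0 < r₀)
    (hG : ∀ x ∈ G, ∀ r, 0 < r → r < r₀ → μH[β] (ball x r) ≤ c' * μ (ball x r))
    (hlarge : ∀ x ∈ G, ∀ s > 0, ∃ r, 0 < r ∧ r ≤ s ∧
      κ * ENNReal.ofReal r ^ β ≤ μ (A ∩ closedBall x r)) : μ G = 0 := by
  have hc0 : c ≠ 0 := (bot_le.trans_lt hcc).ne'
  have hc't : c' ≠ ∞ := hcc.ne_top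
  set C : ℝ≥0∞ := 6 ^ β / (c * κ) with hC
  have hCt : C ≠ ∞ := ENNReal.div_ne_top (ENNReal.rpow_ne_top_of_nonneg hβ.le (by simp))
    (mul_ne_zero hc0 hκ)
  have hO : ∀ O : Set X, G ⊆ O → IsOpen O → c * μ G ≤ c' * μ O := by
    intro O hGO hOo
    obtain ⟨η', hη', hη'η⟩ : ∃ η' : ℝ, 0 < η' ∧ ENNReal.ofReal η' ≤ η := by
      obtain ⟨q, hq, hqη⟩ := ENNReal.lt_iff_exists_nnreal_btwn.1 hη
      exact ⟨q, by exact_mod_cast hq, by simpa using hqη.le⟩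
    obtain ⟨u, huc, hu, hud, hu0⟩ := exists_disjoint_closedBall_covering (μ.restrict A) hP hPs hGP
      C.toNNReal (fun x r => 0 < r ∧ r < r₀ ∧ closedBall x r ⊆ O) (by
        intro x hx ε hε
        obtain ⟨δ, hδ, hδO⟩ := Metric.isOpen_iff.1 hOo x (hGO hx)
        obtain ⟨r, hr, hrs, hκr⟩ := hlarge x hx (min (min ε (δ / 2)) (min (r₀ / 2) (η' / 6)))
          (by positivity)
        simp only [le_min_iff] at hrs
        refine ⟨r, hr, hrs.1.1, ⟨hr, by linarith,
          (closedBall_subset_ball (by linarith)).trans hδO⟩, ?_⟩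
        rw [Measure.restrict_apply measurableSet_closedBall,
          Measure.restrict_apply measurableSet_closedBall, Set.inter_comm, Set.inter_comm _ A,
          ENNReal.coe_toNNReal hCt]
        have hdiam : ediam (closedBall x (3 * r)) ≤ 6 * ENNReal.ofReal r := by
          refine ediam_le fun y hy z hz => ?_
          rw [mem_closedBall] at hy hz
          rw [show (6 : ℝ≥0∞) = ENNReal.ofReal 6 by norm_num, ← ENNReal.ofReal_mul (by norm_num),
            edist_dist]
          exact ENNReal.ofReal_le_ofReal (by linarith [dist_triangle_right y z x])
        have h6 : (6 : ℝ≥0∞) * ENNReal.ofReal r ≤ η := by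
          refine le_trans ?_ hη'η
          rw [show (6 : ℝ≥0∞) = ENNReal.ofReal 6 by norm_num, ← ENNReal.ofReal_mul (by norm_num)]
          exact ENNReal.ofReal_le_ofReal (by linarith)
        have h7 : c * μ (A ∩ closedBall x (3 * r)) ≤ 6 ^ β * ENNReal.ofReal r ^ β := by
          rw [← ENNReal.mul_rpow_of_nonneg _ _ hβ.le]
          exact (hA _ (hdiam.trans h6)).trans (ENNReal.rpow_le_rpow hdiam hβ.le)
        have hκt : κ ≠ ∞ := by
          rintro rfl
          rw [ENNReal.top_mul (by simp [hr])] at hκr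
          exact (measure_ne_top _ _) (top_le_iff.1 hκr)
        rw [hC, ENNReal.mul_comm_div, ← mul_div_assoc,
          ENNReal.le_div_iff_mul_le (Or.inl (mul_ne_zero hc0 hκ))
          (Or.inl (ENNReal.mul_ne_top hc hκt))]
        calc μ (A ∩ closedBall x (3 * r)) * (c * κ)
            = κ * (c * μ (A ∩ closedBall x (3 * r))) := by ring
          _ ≤ κ * (6 ^ β * ENNReal.ofReal r ^ β) := by gcongr
          _ = 6 ^ β * (κ * ENNReal.ofReal r ^ β) := by ring
          _ ≤ 6 ^ β * μ (A ∩ closedBall x r) := by gcongr)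
    have : Countable u := huc.to_subtype
    have hG0 : μ (G \ ⋃ a ∈ u, closedBall a.1 a.2) = 0 := by
      rw [Measure.restrict_apply' hAm] at hu0
      refine measure_mono_null ?_ hu0
      exact fun z hz => ⟨hz, hGA hz.1⟩
    have hcov : μ G ≤ ∑' a : u, μ (A ∩ closedBall a.1.1 a.1.2) := by
      calc μ G ≤ μ (A ∩ ⋃ a ∈ u, closedBall a.1 a.2) + μ (G \ ⋃ a ∈ u, closedBall a.1 a.2) := by
            refine (measure_mono fun z hz => ?_).trans (measure_union_le _ _)
            by_cases hz' : z ∈ ⋃ a ∈ u, closedBall a.1 a.2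
            · exact Or.inl ⟨hGA hz, hz'⟩
            · exact Or.inr ⟨hz, hz'⟩
        _ = μ (⋃ a : u, A ∩ closedBall a.1.1 a.1.2) := by
            rw [hG0, add_zero, ← Set.inter_iUnion, Set.biUnion_eq_iUnion]
        _ ≤ _ := measure_iUnion_le _
    calc c * μ G ≤ ∑' a : u, c * μ (A ∩ closedBall a.1.1 a.1.2) := by
          rw [ENNReal.tsum_mul_left]; gcongr
      _ ≤ ∑' a : u, c' * μ (closedBall a.1.1 a.1.2) := by
          refine ENNReal.tsum_le_tsum fun a => ?_
          obtain ⟨haG, har, har0, -⟩ := hu a.1 a.2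
          exact (mul_measure_inter_le_hausdorffMeasure hβ hη hA _).trans
            (hausdorffMeasure_closedBall_le hc't har0 har (hG _ haG))
      _ = c' * μ (⋃ a : u, closedBall a.1.1 a.1.2) := by
          rw [ENNReal.tsum_mul_left, measure_iUnion (f := fun a : u => closedBall a.1.1 a.1.2)
            (fun a b hab => hud a.2 b.2 fun h => hab (Subtype.ext h))
            fun a => measurableSet_closedBall]
      _ ≤ c' * μ O := by
          gcongr
          exact Set.iUnion_subset fun a => (hu a.1 a.2).2.2.2
  have hle : c * μ G ≤ c' * μ G := by
    have ht : Tendsto (fun ε : ℝ≥0∞ => c' * (μ G + ε)) (𝓝[>] 0) (𝓝 (c' * (μ G + 0))) :=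
      ENNReal.Tendsto.const_mul (tendsto_const_nhds.add
        (tendsto_id.mono_left nhdsWithin_le_nhds)) (Or.inr hc't)
    rw [add_zero] at ht
    refine ge_of_tendsto ht ?_
    filter_upwards [self_mem_nhdsWithin] with ε hε
    obtain ⟨O, hGO, hOo, hlt⟩ := G.exists_isOpen_lt_add (measure_ne_top μ G) (ne_of_gt hε)
    exact (hO O hGO hOo).trans (by gcongr)
  by_contra h0
  exact absurd hle (not_le.2 (ENNReal.mul_lt_mul_left h0 (measure_ne_top _ _) hcc))

/-- If `c μ(A ∩ U) ≤ diam(U) ^ β` for all small sets `U`, then the points of `A` around which the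
Hausdorff measure of small balls is at most `c' < c` times their `μ`-measure form a null set. -/
lemma measure_eq_zero_of_hausdorffMeasure_ball_le (hβ : 0 < β) {μ : Measure X}
    [IsFiniteMeasure μ]
    {A P E : Set X} {c c' η : ℝ≥0∞} (hη : 0 < η) (hc : c ≠ ∞) (hcc : c' < c)
    (hAm : MeasurableSet A)
    (hA : ∀ U : Set X, ediam U ≤ η → c * μ (A ∩ U) ≤ ediam U ^ β)
    (hP : IsOpen P) (hPH : μH[β] P ≠ ∞) (hEP : E ⊆ P) (hEA : E ⊆ A)
    {r₀ : ℝ} (hr₀ : 0 < r₀)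
    (hE : ∀ x ∈ E, ∀ r, 0 < r → r < r₀ → μH[β] (ball x r) ≤ c' * μ (ball x r)) :
    μ E = 0 := by
  have hc0 : c ≠ 0 := (bot_le.trans_lt hcc).ne'
  let κ : ℕ → ℝ≥0∞ := fun j => (j + 1 : ℝ≥0∞)⁻¹
  let F : ℕ → ℕ → Set X := fun j m => {x ∈ E | ∀ r, 0 < r → r ≤ 1 / ((m : ℝ) + 1) →
    μ (A ∩ closedBall x r) ≤ κ j * ENNReal.ofReal r ^ β}
  have hF : ∀ j, μ (⋃ m, F j m) ≤ κ j * (μH[β] P + 1) := by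
    intro j
    have hmono : Monotone (F j) := by
      intro m n hmn x hx
      refine ⟨hx.1, fun r hr hrn => hx.2 r hr (hrn.trans ?_)⟩
      gcongr
    rw [hmono.measure_iUnion]
    refine iSup_le fun m => ?_
    refine measure_le_of_forall_closedBall_le hβ hη hc0 hA (fun x hx => hEA hx.1)
      (s := 1 / ((m : ℝ) + 1)) (by positivity) (fun x hx => hx.2) ?_
    exact (measure_mono fun x hx => hEP hx.1).trans_lt (ENNReal.lt_add_right hPH one_ne_zero)
  have hinter : μ (⋂ j, ⋃ m, F j m) = 0 := by
    have ht : Tendsto (fun j => κ j * (μH[β] P + 1)) atTop (𝓝 (0 * (μH[β] P + 1))) := by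
      refine ENNReal.Tendsto.mul_const ?_ (Or.inr (by simp [hPH]))
      have := ENNReal.tendsto_inv_nat_nhds_zero.comp (tendsto_add_atTop_nat 1)
      refine this.congr fun j => by simp [κ]
    rw [zero_mul] at ht
    exact le_antisymm (ge_of_tendsto' ht fun j => (measure_mono (Set.iInter_subset _ j)).trans
      (hF j)) bot_le
  have hdiff : ∀ j, μ (E \ ⋃ m, F j m) = 0 := by
    intro j
    refine measure_eq_zero_of_closedBall_large hβ hη hc hcc (κ := κ j) (by simp [κ]) hAm hA hP
      (isSeparable_of_hausdorffMeasure_ne_top hβ hPH) (fun x hx => hEP hx.1)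
      (fun x hx => hEA hx.1) hr₀ (fun x hx => hE x hx.1) ?_
    rintro x ⟨hxE, hx⟩ s hs
    obtain ⟨m, hm⟩ := exists_nat_one_div_lt hs
    have : x ∉ F j m := fun h => hx (Set.mem_iUnion_of_mem m h)
    simp only [F, Set.mem_sep_iff, not_and, not_forall, not_le] at this
    obtain ⟨r, hr, hrm, hlt⟩ := this hxE
    exact ⟨r, hr, hrm.trans hm.le, hlt.le⟩
  refine measure_mono_null (fun x hx => ?_)
    (measure_union_null hinter (measure_iUnion_null hdiff))
  by_cases h : x ∈ ⋂ j, ⋃ m, F j m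
  · exact Or.inl h
  · simp only [Set.mem_iInter, not_forall] at h
    obtain ⟨j, hj⟩ := h
    exact Or.inr (Set.mem_iUnion_of_mem j ⟨hx, hj⟩)

end Density

section Separable

variable {X : Type*} [MetricSpace X] [MeasurableSpace X] [BorelSpace X] {β : ℝ}

lemma isSeparable_setOf_forall_measure_ball_pos (μ : Measure X) [IsFiniteMeasure μ] :
    TopologicalSpace.IsSeparable {x : X | ∀ r > 0, 0 < μ (ball x r)} := by
  set Z := {x : X | ∀ r > 0, 0 < μ (ball x r)}
  have := EMetric.subset_countable_closure_of_almost_dense_set Z fun ε hε => ?_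
  · obtain ⟨t, -, htc, hst⟩ := this
    exact ⟨t, htc, hst⟩
  obtain ⟨δ, hδ, hδε⟩ := ENNReal.lt_iff_exists_nnreal_btwn.1 hε
  have hδ0 : (0 : ℝ) < δ := by exact_mod_cast hδ
  obtain ⟨u, huZ, hud, hu⟩ := Vitali.exists_disjoint_subfamily_covering_enlargement_closedBall
    Z id (fun _ => (δ : ℝ) / 4) (δ / 4) (fun _ _ => le_rfl) 4 (by norm_num)
  refine ⟨u, ?_, fun x hx => ?_⟩
  · have h := Measure.countable_meas_pos_of_disjoint_iUnion (μ := μ)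
      (As := fun a : u => closedBall (a : X) (δ / 4)) (fun a => measurableSet_closedBall)
      (fun a b hab => hud a.2 b.2 fun h => hab (Subtype.ext h))
    have h' : {a : u | 0 < μ (closedBall (a : X) (δ / 4))} = Set.univ :=
      Set.eq_univ_of_forall fun a => (huZ a.2 (δ / 4) (by positivity)).trans_le
        (measure_mono ball_subset_closedBall)
    rw [h'] at h
    exact Set.countable_coe_iff.1 (Set.countable_univ_iff.1 h)
  · obtain ⟨b, hb, hxb⟩ := hu x hx
    refine Set.mem_biUnion hb ?_
    have : x ∈ closedBall b (4 * (δ / 4 : ℝ)) := hxb (mem_closedBall_self (by positivity))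
    rw [mem_closedBall, dist_nndist] at this
    refine le_trans ?_ hδε.le
    rw [edist_nndist]
    have h4 : (nndist x b : ℝ) ≤ δ := by linarith
    exact_mod_cast h4

lemma exists_measurable_eqOn_edist {Z : Set X} (hZ : TopologicalSpace.IsSeparable Z) {S : X → X}
    (hS : Measurable S) : ∃ f : X → ℝ≥0∞, Measurable f ∧ ∀ x ∈ Z, f x = edist (S x) x := by
  obtain ⟨q, hqZ, hqc, hq⟩ := hZ.exists_countable_dense_subset
  refine ⟨fun x => ⨅ y ∈ q, (edist (S x) y + edist y x), ?_, fun x hx => ?_⟩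
  · refine Measurable.biInf _ hqc fun y _ => ?_
    have h1 : Measurable fun z : X => edist z y := measurable_edist_left
    exact (h1.comp hS).add measurable_edist_right
  · refine le_antisymm ?_ (le_iInf₂ fun y _ => edist_triangle _ _ _)
    refine ENNReal.le_of_forall_pos_le_add fun ε hε _ => ?_
    obtain ⟨y, hy, hxy⟩ := EMetric.mem_closure_iff.1 (hq hx) (ε / 2 : ℝ≥0) (by positivity)
    refine (iInf₂_le y hy).trans ?_
    calc edist (S x) y + edist y x ≤ edist (S x) x + edist x y + edist x y := by
          rw [edist_comm y x]; gcongr; exact edist_triangle _ _ _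
      _ ≤ edist (S x) x + (ε / 2 : ℝ≥0) + (ε / 2 : ℝ≥0) := by gcongr
      _ = edist (S x) x + ε := by
          rw [add_assoc, ← ENNReal.coe_add, add_halves]

variable {μ : Measure X} [IsProbabilityMeasure μ] {T : X → X}

/-- Points of `Z` whose orbit returns slowly. -/
def slowReturnSet (T : X → X) (Z : Set X) (β : ℝ) (c η : ℝ≥0∞) (N : ℕ) : Set X :=
  {x ∈ Z | (∀ n, N ≤ n → c < n * edist (T^[n] x) x ^ β) ∧
    ∀ n, n ≠ 0 → n < N → η < edist (T^[n] x) x}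

lemma measurableSet_slowReturnSet (hT : Measurable T) {Z : Set X} (hZc : IsClosed Z)
    (hZ : TopologicalSpace.IsSeparable Z) (c η : ℝ≥0∞) (N : ℕ) :
    MeasurableSet (slowReturnSet T Z β c η N) := by
  choose f hfm hf using fun n : ℕ => exists_measurable_eqOn_edist hZ (hT.iterate n)
  have : slowReturnSet T Z β c η N = Z ∩ ((⋂ (n) (_ : N ≤ n), {x | c < n * f n x ^ β}) ∩
      ⋂ (n) (_ : n ≠ 0) (_ : n < N), {x | η < f n x}) := by
    ext x
    simp only [slowReturnSet, Set.mem_inter_iff, Set.mem_iInter, Set.mem_ofPred_eq]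
    refine and_congr_right fun hx => ?_
    simp only [hf _ x hx]
  rw [this]
  refine hZc.measurableSet.inter (MeasurableSet.inter ?_ ?_)
  · exact MeasurableSet.iInter fun n => MeasurableSet.iInter fun _ =>
      measurableSet_lt measurable_const (((hfm n).pow_const β).const_mul _)
  · exact MeasurableSet.iInter fun n => MeasurableSet.iInter fun _ => MeasurableSet.iInter fun _ =>
      measurableSet_lt measurable_const (hfm n)

lemma mul_measure_slowReturnSet_inter_le (hT : MeasurePreserving T μ μ) (hβ : 0 < β) {Z : Set X}
    (hZc : IsClosed Z) (hZ : TopologicalSpace.IsSeparable Z) {c η : ℝ≥0∞} (hc : c ≠ ∞) (N : ℕ)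
    (U : Set X) (hU : ediam U ≤ η) :
    c * μ (slowReturnSet T Z β c η N ∩ U) ≤ ediam U ^ β := by
  set V := slowReturnSet T Z β c η N ∩ closure U
  have hV : MeasurableSet V :=
    (measurableSet_slowReturnSet hT.measurable hZc hZ c η N).inter isClosed_closure.measurableSet
  calc c * μ (slowReturnSet T Z β c η N ∩ U) ≤ c * μ V := by
        exact mul_le_mul_right (measure_mono (Set.inter_subset_inter_right _ subset_closure)) c
    _ ≤ ∫⁻ _, ediam U ^ β ∂μ := by
        refine mul_measure_le_lintegral_of_separated_visits hT hV hc measurable_const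
          (ae_of_all _ fun x i j hij hi hj => ?_)
        have hk : T^[j] x = T^[j - i] (T^[i] x) := by
          rw [← Function.iterate_add_apply, Nat.sub_add_cancel hij.le]
        rw [hk] at hj
        have hd : edist (T^[j - i] (T^[i] x)) (T^[i] x) ≤ ediam U := by
          rw [← ediam_closure]
          exact edist_le_ediam_of_mem hj.2 hi.2
        rcases lt_or_ge (j - i) N with hN | hN
        · exact absurd (hi.1.2.2 _ (by omega) hN) (not_lt.2 (hd.trans hU))
        · exact (hi.1.2.1 _ hN).le.trans (by gcongr)
    _ = ediam U ^ β := by simp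

lemma iterate_ne_of_eventually_lt {X : Type*} [MetricSpace X] {T : X → X} {β : ℝ} (hβ : 0 < β) {c : ℝ≥0∞} {x : X}
    (h : ∀ᶠ n : ℕ in atTop, c < n * edist (T^[n] x) x ^ β) {n : ℕ} (hn : n ≠ 0) :
    T^[n] x ≠ x := by
  intro hx
  obtain ⟨N, hN⟩ := eventually_atTop.1 h
  have := hN (n * N) (Nat.le_mul_of_pos_left N (Nat.pos_of_ne_zero hn))
  rw [Function.iterate_mul, Function.iterate_fixed hx, edist_self, ENNReal.zero_rpow_of_pos hβ,
    mul_zero] at this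
  exact not_lt_bot this

/-- The recurrence estimate at the points of a separable closed set. -/
lemma ae_not_of_isSeparable (hT : MeasurePreserving T μ μ) (hβ : 0 < β) {Z : Set X}
    (hZc : IsClosed Z) (hZ : TopologicalSpace.IsSeparable Z) {c c' : ℝ≥0∞} (hc : c ≠ ∞)
    (hcc : c' < c) :
    ∀ᵐ x ∂μ, x ∈ Z → (∀ᶠ n : ℕ in atTop, c < n * edist (T^[n] x) x ^ β) →
      ¬ ∀ᶠ r in 𝓝[>] (0 : ℝ), μH[β] (ball x r) ≤ c' * μ (ball x r) := by
  let E : ℕ → ℕ → ℕ → Set X := fun N k m => {x ∈ slowReturnSet T Z β c (k : ℝ≥0∞)⁻¹ N |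
    ∀ r, 0 < r → r < 1 / ((m : ℝ) + 1) → μH[β] (ball x r) ≤ c' * μ (ball x r)}
  have hE : ∀ N k m, μ (E N k m) = 0 := by
    intro N k m
    have hm : (0 : ℝ) < 1 / ((m : ℝ) + 1) := by positivity
    obtain ⟨q, hqE, hqc, hq⟩ := exists_countable_biUnion_ball
      (hZ.mono fun x (hx : x ∈ E N k m) => hx.1.1) (1 / ((m : ℝ) + 1) / 2)
    have hcov : E N k m ⊆ ⋃ y ∈ q, (E N k m ∩ ball y (1 / ((m : ℝ) + 1) / 2)) := by
      rw [← Set.inter_iUnion₂, ← hq]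
      exact fun x hx => ⟨hx, Set.mem_biUnion hx (mem_ball_self (by positivity))⟩
    refine measure_mono_null hcov ((measure_biUnion_null_iff hqc).2 fun y hy => ?_)
    refine measure_eq_zero_of_hausdorffMeasure_ball_le hβ (η := (k : ℝ≥0∞)⁻¹) (by simp) hc hcc
      (measurableSet_slowReturnSet hT.measurable hZc hZ c (k : ℝ≥0∞)⁻¹ N)
      (mul_measure_slowReturnSet_inter_le hT hβ hZc hZ hc N) isOpen_ball ?_ Set.inter_subset_right
      (fun x hx => hx.1.1) hm fun x hx => hx.1.2
    exact (((hqE hy).2 _ (by positivity) (by linarith)).trans_lt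
      (ENNReal.mul_lt_top hcc.lt_top (measure_lt_top _ _))).ne
  have hnull : μ (⋃ N, ⋃ k, ⋃ m, E N k m) = 0 :=
    measure_iUnion_null fun N => measure_iUnion_null fun k => measure_iUnion_null fun m => hE N k m
  filter_upwards [measure_eq_zero_iff_ae_notMem.1 hnull] with x hx hxZ hlt hr
  refine hx ?_
  obtain ⟨N, hN⟩ := eventually_atTop.1 hlt
  obtain ⟨u, hu, hur⟩ := mem_nhdsGT_iff_exists_Ioo_subset.1 hr
  obtain ⟨m, hm⟩ := exists_nat_one_div_lt (Set.mem_Ioi.1 hu)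
  have hk : ∀ᶠ k : ℕ in atTop, ∀ n ∈ Finset.range N, n ≠ 0 →
      (k : ℝ≥0∞)⁻¹ < edist (T^[n] x) x := by
    rw [eventually_all_finset]
    intro n _
    rcases eq_or_ne n 0 with rfl | hn
    · simp
    · filter_upwards [ENNReal.tendsto_inv_nat_nhds_zero.eventually_lt_const
        (edist_pos.2 (iterate_ne_of_eventually_lt hβ hlt hn))] with k hk _ using hk
  obtain ⟨k, hk⟩ := hk.exists
  simp only [Set.mem_iUnion]
  exact ⟨N, k, m, ⟨hxZ, hN, fun n hn hnN => hk n (Finset.mem_range.2 hnN) hn⟩,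
    fun r hr hrm => hur ⟨hr, hrm.trans hm⟩⟩

end Separable

section Labelling

/-- A function on a separable metric space all of whose preimages are Borel takes almost surely
only countably many values, with respect to any finite measure. -/
lemma exists_countable_measure_preimage_compl_eq_zero {Y E : Type*} [MetricSpace Y]
    [SecondCountableTopology Y] [MeasurableSpace Y] [BorelSpace Y] (m : Measure Y)
    [IsFiniteMeasure m] (g : Y → E) (hg : ∀ S : Set E, MeasurableSet (g ⁻¹' S)) :
    ∃ F : Set E, F.Countable ∧ m (g ⁻¹' Fᶜ) = 0 := by
  let _ : MeasurableSpace E := ⊤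
  obtain ⟨_, _⟩ := exists_wellFoundedLT E
  have hgm : Measurable g := fun S _ => hg S
  set F : Set E := {e | 0 < m (g ⁻¹' {e})}
  refine ⟨F, ?_, ?_⟩
  · exact Measure.countable_meas_pos_of_disjoint_iUnion (fun e => hg {e}) fun a b hab =>
      Disjoint.preimage _ (Set.disjoint_singleton.2 hab)
  by_contra hF
  have hpt : ∀ e, m (g ⁻¹' (Fᶜ ∩ {e})) = 0 := by
    intro e
    by_cases he : e ∈ F
    · rw [Set.inter_singleton_eq_empty.2 (by simpa using he)]; simp
    · have : m (g ⁻¹' {e}) = 0 := by simpa [F] using he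
      exact measure_mono_null (Set.preimage_mono Set.inter_subset_right) this
  obtain ⟨J, hJ, hJnull⟩ : ∃ J : Set E, m (g ⁻¹' (Fᶜ ∩ J)) ≠ 0 ∧
      ∀ w ∈ J, m (g ⁻¹' (Fᶜ ∩ Set.Iic w)) = 0 := by
    by_cases h : ∃ w, m (g ⁻¹' (Fᶜ ∩ Set.Iic w)) ≠ 0
    · obtain ⟨z, hz, hmin⟩ := WellFounded.has_min (wellFounded_lt (α := E))
        {w | m (g ⁻¹' (Fᶜ ∩ Set.Iic w)) ≠ 0} h
      refine ⟨Set.Iio z, fun h0 => hz ?_, fun w hw => ?_⟩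
      · refine measure_mono_null ?_ (measure_union_null h0 (hpt z))
        rw [← Set.preimage_union, ← Set.inter_union_distrib_left]
        exact Set.preimage_mono (Set.inter_subset_inter_right _ (by simp))
      · by_contra h'
        exact hmin w h' hw
    · push Not at h
      exact ⟨Set.univ, by simpa using hF, fun w _ => h w⟩
  set K := Fᶜ ∩ J
  set m' := m.restrict (g ⁻¹' K)
  set θ := m'.map g
  have hθu : θ Set.univ = m' Set.univ := by
    rw [Measure.map_apply hgm MeasurableSet.univ, Set.preimage_univ]
  have hm'u : m' Set.univ ≠ 0 := by simpa [m'] using hJ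
  set ε := m' Set.univ / 2
  have hε : 0 < ε := ENNReal.half_pos hm'u
  have hnull : ∀ w ∈ J, m' (g ⁻¹' Set.Iic w) = 0 := by
    intro w hw
    rw [Measure.restrict_apply (hg _)]
    refine measure_mono_null ?_ (hJnull w hw)
    exact fun y hy => ⟨hy.2.1, hy.1⟩
  have hO : ∀ w, ∃ O : Set Y, IsOpen O ∧ m' O ≤ ε ∧ (w ∈ J → g ⁻¹' Set.Iic w ⊆ O) := by
    intro w
    by_cases hw : w ∈ J
    · obtain ⟨O, hO, hOo, hlt⟩ := Set.exists_isOpen_lt_of_lt (μ := m') (g ⁻¹' Set.Iic w) ε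
        (by rw [hnull w hw]; exact hε)
      exact ⟨O, hOo, hlt.le, fun _ => hO⟩
    · exact ⟨∅, isOpen_empty, by simp, fun h => absurd h hw⟩
  choose O hOo hOε hO using hO
  set R : Set (Y × E) := {p | p.1 ∈ O p.2}
  have hR : MeasurableSet R := by
    have : R = ⋃ U ∈ TopologicalSpace.countableBasis Y, U ×ˢ {w | U ⊆ O w} := by
      ext ⟨y, w⟩
      simp only [R, Set.mem_iUnion, Set.mem_prod, exists_prop]
      constructor
      · intro h
        obtain ⟨U, hU, hyU, hUO⟩ :=
          (TopologicalSpace.isBasis_countableBasis Y).exists_subset_of_mem_open h (hOo w)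
        exact ⟨U, hU, hyU, hUO⟩
      · rintro ⟨U, -, hyU, hUO⟩
        exact hUO hyU
    rw [this]
    refine MeasurableSet.biUnion (TopologicalSpace.countable_countableBasis Y) fun U hU => ?_
    exact (TopologicalSpace.isOpen_of_mem_countableBasis hU).measurableSet.prod trivial
  have h1 : (m'.prod θ) R ≤ ε * m' Set.univ := by
    rw [Measure.prod_apply_symm hR, ← hθu]
    calc ∫⁻ w, m' ((fun y => (y, w)) ⁻¹' R) ∂θ ≤ ∫⁻ _, ε ∂θ := lintegral_mono fun w => hOε w
      _ = ε * θ Set.univ := by simp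
  have h2 : m' Set.univ * m' Set.univ ≤ (m'.prod θ) R := by
    rw [Measure.prod_apply hR]
    calc m' Set.univ * m' Set.univ = ∫⁻ _, θ Set.univ ∂m' := by simp [hθu]
      _ ≤ ∫⁻ y, θ (Prod.mk y ⁻¹' R) ∂m' := by
          refine lintegral_mono_ae ?_
          filter_upwards [ae_restrict_mem (hg K)] with y hy
          have hc : θ (Prod.mk y ⁻¹' R)ᶜ = 0 := by
            rw [Measure.map_apply hgm trivial]
            refine measure_mono_null (t := g ⁻¹' Set.Iic (g y) ∪ g ⁻¹' Kᶜ) ?_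
              (measure_union_null (hnull _ hy.2) ?_)
            · intro z hz
              by_contra hz'
              simp only [Set.mem_union, not_or, Set.mem_preimage, Set.mem_Iic, not_le,
                Set.mem_compl_iff, not_not] at hz'
              exact hz (hO (g z) hz'.2.2 (show g y ≤ g z from hz'.1.le))
            · rw [Measure.restrict_apply (hg _), ← Set.preimage_inter]
              simp
          rw [← measure_add_measure_compl (μ := θ) (s := Prod.mk y ⁻¹' R) trivial, hc, add_zero]
      _ = _ := rfl
  have h3 : m' Set.univ ≤ ε :=
    (ENNReal.mul_le_mul_iff_left hm'u (measure_ne_top _ _)).1 (h2.trans h1)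
  exact absurd h3 (not_le.2 (ENNReal.half_lt_self hm'u (measure_ne_top _ _)))

end Labelling

section Fibres

lemma eq_zero_of_forall_le_mul {a b : ℝ≥0∞} (hb : b ≠ ∞) (h : ∀ ε > 0, a ≤ ε * b) : a = 0 := by
  have ht : Tendsto (fun ε : ℝ≥0∞ => ε * b) (𝓝[>] 0) (𝓝 (0 * b)) :=
    ENNReal.Tendsto.mul_const (tendsto_id.mono_left nhdsWithin_le_nhds) (Or.inr hb)
  rw [zero_mul] at ht
  refine le_antisymm (ge_of_tendsto ht ?_) bot_le
  filter_upwards [self_mem_nhdsWithin] with ε hε using h ε hε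

open scoped Classical in
/-- A fibred version of `exists_countable_measure_preimage_compl_eq_zero`. -/
lemma exists_countable_fibrewise {Y D E : Type*} [MetricSpace Y] [MeasurableSpace Y]
    [BorelSpace Y] (ν : Measure Y) [IsFiniteMeasure ν] {L : Y → D} (hL : IsLocallyConstant L)
    (hs : ∀ d, TopologicalSpace.IsSeparable (L ⁻¹' {d})) (g : Y → E)
    (hg : ∀ S : Set E, MeasurableSet (g ⁻¹' S)) :
    ∃ F : D → Set E, (∀ d, (F d).Countable) ∧ ∀ᵐ y ∂ν, g y ∈ F (L y) := by
  let _ : MeasurableSpace D := ⊤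
  have hsc : ∀ d, SecondCountableTopology (L ⁻¹' {d}) := fun d => by
    have := (hs d).separableSpace
    exact UniformSpace.secondCountable_of_separable _
  obtain ⟨B, hBo, hB⟩ : ∃ B : ℕ → Set Y, (∀ i, IsOpen (B i)) ∧ ∀ d,
      borel (L ⁻¹' {d}) ≤
        MeasurableSpace.generateFrom (Set.range fun i => ((↑) : L ⁻¹' {d} → Y) ⁻¹' B i) := by
    have h : ∀ d, ∃ b : ℕ → Set (L ⁻¹' {d}),
        insert ∅ (TopologicalSpace.countableBasis (L ⁻¹' {d})) = Set.range b := fun d =>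
      ((TopologicalSpace.countable_countableBasis _).insert ∅).exists_eq_range
        (Set.insert_nonempty _ _)
    choose b hb using h
    have hbo : ∀ d i, IsOpen (b d i) := by
      intro d i
      have : b d i ∈ insert ∅ (TopologicalSpace.countableBasis (L ⁻¹' {d})) := by
        rw [hb]; exact Set.mem_range_self i
      rcases this with h | h
      · rw [h]; exact isOpen_empty
      · exact TopologicalSpace.isOpen_of_mem_countableBasis h
    refine ⟨fun i => ⋃ d, ((↑) : L ⁻¹' {d} → Y) '' b d i, fun i => isOpen_iUnion fun d =>
      (hL {d}).isOpenMap_subtype_val _ (hbo d i), fun d => ?_⟩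
    rw [(TopologicalSpace.isBasis_countableBasis (L ⁻¹' {d})).borel_eq_generateFrom]
    refine MeasurableSpace.generateFrom_mono ?_
    intro U hU
    have : U ∈ Set.range (b d) := by rw [← hb]; exact Set.mem_insert_of_mem _ hU
    obtain ⟨i, rfl⟩ := this
    refine ⟨i, ?_⟩
    ext y
    simp only [Set.mem_preimage, Set.mem_iUnion, Set.mem_image]
    constructor
    · rintro ⟨d', z, hz, hzy⟩
      have h1 : L z = d' := z.2
      have h2 : L y = d := y.2
      have : d' = d := by rw [← h1, ← h2, hzy]
      subst this
      rwa [Subtype.ext hzy] at hz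
    · exact fun hy => ⟨d, y, hy, rfl⟩
  let φ : Y → ℕ → Bool := fun y i => decide (y ∈ B i)
  have hφ : Measurable φ := measurable_pi_lambda _ fun i =>
    (measurable_to_bool (by
      have : (fun y => φ y i) ⁻¹' {true} = B i := by ext y; simp [φ]
      rw [this]; exact (hBo i).measurableSet))
  have hLm : Measurable L := fun S _ => (hL S).measurableSet
  set ρ : Measure (D × (ℕ → Bool)) := ν.map fun y => (L y, φ y)
  have hρf : IsFiniteMeasure ρ := inferInstance
  set κ := ρ.condKernel
  have hF : ∀ d, ∃ F : Set E, F.Countable ∧ κ d (φ '' {y | L y = d ∧ g y ∉ F}) = 0 := by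
    intro d
    let o : OuterMeasure (L ⁻¹' {d}) :=
      OuterMeasure.comap (fun y : L ⁻¹' {d} => φ y) (κ d).toOuterMeasure
    have ho : (inferInstance : MeasurableSpace (L ⁻¹' {d})) ≤ o.caratheodory := by
      rw [BorelSpace.measurable_eq (α := L ⁻¹' {d})]
      refine (hB d).trans (MeasurableSpace.generateFrom_le ?_)
      rintro _ ⟨i, rfl⟩
      rw [OuterMeasure.isCaratheodory_iff]
      intro t
      have hC : MeasurableSet {ω : ℕ → Bool | ω i = true} :=
        measurableSet_eq_fun (measurable_pi_apply i) measurable_const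
      have h1 : (fun y : L ⁻¹' {d} => φ y) '' (t ∩ (↑) ⁻¹' B i)
          = (fun y : L ⁻¹' {d} => φ y) '' t ∩ {ω : ℕ → Bool | ω i = true} := by
        rw [← Set.image_inter_preimage]
        congr 2
        ext y; simp [φ]
      have h2 : (fun y : L ⁻¹' {d} => φ y) '' (t \ (↑) ⁻¹' B i)
          = (fun y : L ⁻¹' {d} => φ y) '' t \ {ω : ℕ → Bool | ω i = true} := by
        rw [Set.sdiff_eq, Set.sdiff_eq, ← Set.image_inter_preimage]
        congr 2
        ext y; simp [φ]
      simp only [o, OuterMeasure.comap_apply, h1, h2]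
      exact (measure_inter_add_sdiff _ hC).symm
    have : IsFiniteMeasure (o.toMeasure ho) := ⟨by
      rw [toMeasure_apply _ _ MeasurableSet.univ]
      exact measure_lt_top (κ d) _⟩
    obtain ⟨F, hFc, hF0⟩ := exists_countable_measure_preimage_compl_eq_zero (o.toMeasure ho)
      (fun y => g y) fun S => measurable_subtype_coe (hg S)
    refine ⟨F, hFc, le_antisymm ?_ bot_le⟩
    refine le_trans ?_ ((le_toMeasure_apply o ho _).trans hF0.le)
    refine measure_mono (μ := κ d) ?_
    rintro _ ⟨y, ⟨hy, hyF⟩, rfl⟩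
    exact ⟨⟨y, hy⟩, hyF, rfl⟩
  choose F hFc hF0 using hF
  refine ⟨F, hFc, ?_⟩
  refine eq_zero_of_forall_le_mul (measure_ne_top ν Set.univ) fun ε hε => ?_
  have hO : ∀ d, ∃ O : Set (ℕ → Bool), φ '' {y | L y = d ∧ g y ∉ F d} ⊆ O ∧ IsOpen O ∧
      κ d O < ε := fun d => Set.exists_isOpen_lt_of_lt _ ε (by rw [hF0]; exact hε)
  choose O hO hOo hOε using hO
  set W : Set (D × (ℕ → Bool)) := {p | p.2 ∈ O p.1}
  have hW : MeasurableSet W := by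
    have : W = ⋃ U ∈ TopologicalSpace.countableBasis (ℕ → Bool), {d | U ⊆ O d} ×ˢ U := by
      ext ⟨d, ω⟩
      simp only [W, Set.mem_iUnion, Set.mem_prod, exists_prop]
      constructor
      · intro h
        obtain ⟨U, hU, hyU, hUO⟩ := (TopologicalSpace.isBasis_countableBasis
          (ℕ → Bool)).exists_subset_of_mem_open h (hOo d)
        exact ⟨U, hU, hUO, hyU⟩
      · rintro ⟨U, -, hUO, hyU⟩
        exact hUO hyU
    rw [this]
    refine MeasurableSet.biUnion (TopologicalSpace.countable_countableBasis _) fun U hU => ?_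
    exact MeasurableSet.prod trivial
      (TopologicalSpace.isOpen_of_mem_countableBasis hU).measurableSet
  calc ν {y | g y ∈ F (L y)}ᶜ ≤ ν ((fun y => (L y, φ y)) ⁻¹' W) :=
        measure_mono fun y hy => hO (L y) ⟨y, ⟨rfl, hy⟩, rfl⟩
    _ = ρ W := (Measure.map_apply (hLm.prodMk hφ) hW).symm
    _ = (ρ.fst.compProd κ) W := by rw [ρ.disintegrate κ]
    _ = ∫⁻ d, κ d (Prod.mk d ⁻¹' W) ∂ρ.fst := Measure.compProd_apply hW
    _ ≤ ∫⁻ _, ε ∂ρ.fst := lintegral_mono fun d => (hOε d).le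
    _ = ε * ν Set.univ := by
        rw [lintegral_const, Measure.fst_univ, Measure.map_apply (hLm.prodMk hφ) MeasurableSet.univ,
          Set.preimage_univ]

end Fibres

section Labels

lemma countable_setOf_reflTransGen {D : Type*} {F : D → Set D} (hF : ∀ d, (F d).Countable)
    (e : D) : {d | Relation.ReflTransGen (fun a b => b ∈ F a) e d}.Countable := by
  let S : ℕ → Set D := fun n => Nat.rec {e} (fun _ s => ⋃ d ∈ s, F d) n
  have hS : ∀ n, (S n).Countable := by
    intro n
    induction n with
    | zero => exact Set.countable_singleton e
    | succ n ih => exact ih.biUnion fun d _ => hF d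
  refine (Set.countable_iUnion hS).mono fun d hd => ?_
  have hd' : Relation.ReflTransGen (fun a b => b ∈ F a) e d := hd
  induction hd' with
  | refl => exact Set.mem_iUnion_of_mem 0 rfl
  | tail hab hbc ih =>
    obtain ⟨n, hn⟩ := Set.mem_iUnion.1 (ih hab)
    exact Set.mem_iUnion_of_mem (n + 1) (Set.mem_biUnion hn hbc)

lemma exists_colouring {D : Type*} [LinearOrder D] [WellFoundedLT D] (h : D → D) :
    ∃ p : D → Prop, ∀ e, h e < e → (p e ↔ ¬ p (h e)) := by
  refine ⟨(wellFounded_lt (α := D)).fix fun e ih => ∀ he : h e < e, ¬ ih (h e) he,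
    fun e he => ?_⟩
  rw [WellFounded.fix_eq]
  exact ⟨fun H => H he, fun H _ => H⟩

/-- If a partial labelling is discretely measurable and the labels seen along an orbit lie almost
surely in a countable set determined by the first label, then labels can be merged countably many
at a time so as to be almost surely constant along orbits. -/
lemma exists_ae_constant_merging {X D : Type*} [MeasurableSpace X] {μ : Measure X}
    [IsFiniteMeasure μ] {T : X → X} (hT : MeasurePreserving T μ μ) {L : X → Option D}
    (hL : ∀ S : Set (Option D), MeasurableSet (L ⁻¹' S)) {F : D → Set D}
    (hFc : ∀ d, (F d).Countable)
    (hF : ∀ᵐ x ∂μ, ∀ n d e, L x = some d → L (T^[n] x) = some e → e ∈ F d) :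
    ∃ ℓ : D → D, (∀ e, (ℓ ⁻¹' {e}).Countable) ∧ ∀ᵐ x ∂μ, ∀ m n d e,
      L (T^[m] x) = some d → L (T^[n] x) = some e → ℓ d = ℓ e := by
  obtain ⟨_, _⟩ := exists_wellFoundedLT D
  let cl : D → Set D := fun e => {d | Relation.ReflTransGen (fun a b => b ∈ F a) e d}
  have hcl : ∀ e, (cl e).Countable := countable_setOf_reflTransGen hFc
  have hne : ∀ d, {e | d ∈ cl e}.Nonempty := fun d => ⟨d, Relation.ReflTransGen.refl⟩
  let ℓ : D → D := fun d => (wellFounded_lt (α := D)).min {e | d ∈ cl e} (hne d)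
  have hℓ : ∀ d, d ∈ cl (ℓ d) := fun d => WellFounded.min_mem _ _ (hne d)
  have hℓle : ∀ d e, d ∈ cl e → ℓ d ≤ e := fun d e h =>
    not_lt.1 (WellFounded.not_lt_min _ {e | d ∈ cl e} (show e ∈ {e | d ∈ cl e} from h))
  have hstep : ∀ d e, e ∈ F d → e ∈ cl (ℓ d) := fun d e h => (hℓ d).tail h
  refine ⟨ℓ, fun e => (hcl e).mono fun d (hd : ℓ d = e) => hd ▸ hℓ d, ?_⟩
  have henum : ∀ e, ∃ h : ℕ → D, ℓ '' cl e = Set.range h := fun e =>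
    ((hcl e).image ℓ).exists_eq_range ⟨ℓ e, e, Relation.ReflTransGen.refl, rfl⟩
  choose h hh using henum
  choose p hp using fun i => exists_colouring fun e => h e i
  have hrec : ∀ s : Set D, ∀ᵐ x ∂μ, x ∈ L ⁻¹' (some '' (ℓ ⁻¹' s)) →
      ∃ᶠ n in atTop, T^[n] x ∈ L ⁻¹' (some '' (ℓ ⁻¹' s)) := fun s =>
    hT.conservative.ae_mem_imp_frequently_image_mem (hL _).nullMeasurableSet
  have hgood : ∀ᵐ x ∂μ, (∀ n d e, L x = some d → L (T^[n] x) = some e → e ∈ F d) ∧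
      ∀ i, (x ∈ L ⁻¹' (some '' (ℓ ⁻¹' {e | p i e})) →
        ∃ᶠ n in atTop, T^[n] x ∈ L ⁻¹' (some '' (ℓ ⁻¹' {e | p i e}))) ∧
      (x ∈ L ⁻¹' (some '' (ℓ ⁻¹' {e | ¬ p i e})) →
        ∃ᶠ n in atTop, T^[n] x ∈ L ⁻¹' (some '' (ℓ ⁻¹' {e | ¬ p i e}))) :=
    hF.and (ae_all_iff.2 fun i => (hrec _).and (hrec _))
  have hgood' := ae_all_iff.2 fun m => (hT.iterate m).quasiMeasurePreserving.ae hgood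
  filter_upwards [hgood'] with x hx
  have hvisit : ∀ m n d e, m ≤ n → L (T^[m] x) = some d → L (T^[n] x) = some e → e ∈ F d := by
    intro m n d e hmn hd he
    refine (hx m).1 (n - m) d e hd ?_
    rwa [← Function.iterate_add_apply, Nat.sub_add_cancel hmn]
  have key : ∀ m n d e, m ≤ n → L (T^[m] x) = some d → L (T^[n] x) = some e → ℓ d = ℓ e := by
    intro m n d e hmn hd he
    have hle : ℓ e ≤ ℓ d := hℓle _ _ (hstep _ _ (hvisit m n d e hmn hd he))
    refine hle.antisymm' (not_lt.1 fun hlt => ?_)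
    obtain ⟨b, ⟨k, e', hmk, he', rfl⟩, hmin⟩ := WellFounded.has_min (wellFounded_lt (α := D))
      {b | ∃ k e', m ≤ k ∧ L (T^[k] x) = some e' ∧ ℓ e' = b} ⟨ℓ e, n, e, hmn, he, rfl⟩
    have hbd : ℓ e' < ℓ d := (not_lt.1 (hmin _ ⟨n, e, hmn, he, rfl⟩)).trans_lt hlt
    have hlater : ∀ j e'', k ≤ j → L (T^[j] x) = some e'' → ℓ e'' = ℓ e' := by
      intro j e'' hkj he''
      exact le_antisymm (hℓle _ _ (hstep _ _ (hvisit k j _ _ hkj he' he'')))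
        (not_lt.1 (hmin _ ⟨j, e'', hmk.trans hkj, he'', rfl⟩))
    obtain ⟨i, hi⟩ : ℓ e' ∈ Set.range (h (ℓ d)) := by
      rw [← hh]
      exact ⟨e', hstep _ _ (hvisit m k _ _ hmk hd he'), rfl⟩
    have hpi : p i (ℓ d) ↔ ¬ p i (ℓ e') := by
      have := hp i (ℓ d)
      simp only [hi] at this
      exact this hbd
    have hcontra : ∀ s : Set D, ℓ e' ∉ s →
        ¬ ∃ᶠ j in atTop, T^[j] (T^[m] x) ∈ L ⁻¹' (some '' (ℓ ⁻¹' s)) := by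
      intro s hs hfr
      obtain ⟨j, hj, e'', he''s, he''⟩ := frequently_atTop.1 hfr k
      rw [← Function.iterate_add_apply] at he''
      exact hs (hlater _ e'' (by omega) he''.symm ▸ he''s)
    by_cases hpd : p i (ℓ d)
    · exact hcontra {e | p i e} (hpi.1 hpd) (((hx m).2 i).1 ⟨d, hpd, hd.symm⟩)
    · exact hcontra {e | ¬ p i e} (fun h' => hpd (hpi.2 h')) (((hx m).2 i).2 ⟨d, hpd, hd.symm⟩)
  intro m n d e hd he
  rcases le_total m n with hmn | hmn
  · exact key m n d e hmn hd he
  · exact (key n m e d hmn he hd).symm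

end Labels

section NullBalls

/-- A set all of whose points have a Hausdorff-null `s`-ball splits into locally constant pieces
which are themselves Hausdorff-null. -/
lemma exists_isLocallyConstant_null_fibres {X : Type*} [MetricSpace X] [MeasurableSpace X]
    [BorelSpace X] {β : ℝ} (hβ : 0 < β) {W : Set X} {s : ℝ} (hs : 0 < s)
    (hW : ∀ x ∈ W, μH[β] (ball x s) = 0) :
    ∃ L : W → W, IsLocallyConstant L ∧ ∀ d, μH[β] (((↑) : W → X) '' (L ⁻¹' {d})) = 0 := by
  let R : W → W → Prop := fun x y => dist x y < s
  refine ⟨fun x => (Quot.mk R x).out, ?_, fun d => ?_⟩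
  · refine (IsLocallyConstant.iff_eventually_eq _).2 fun x => ?_
    filter_upwards [ball_mem_nhds x hs] with y hy
    exact congrArg Quot.out (Quot.sound (r := R) (mem_ball.1 hy))
  rcases ((fun x => (Quot.mk R x).out) ⁻¹' {d}).eq_empty_or_nonempty with he | ⟨x, hx⟩
  · rw [he]; simp
  let C : ℕ → Set X := fun n => Nat.rec {(x : X)} (fun _ s' => W ∩ ⋃ y ∈ s', ball y s) n
  have hCW : ∀ n, C n ⊆ W := fun n => by
    cases n with
    | zero => exact Set.singleton_subset_iff.2 x.2
    | succ n => exact Set.inter_subset_left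
  have : NullSingletonClass (μH[β] : Measure X) := Measure.nullSingletonClass_hausdorff X hβ
  have hC0 : ∀ n, μH[β] (C n) = 0 := by
    intro n
    induction n with
    | zero => exact measure_singleton (μ := (μH[β] : Measure X)) (x : X)
    | succ n ih =>
      obtain ⟨q, hqC, hqc, hq⟩ := exists_countable_biUnion_ball
        (isSeparable_of_hausdorffMeasure_ne_top hβ (s := C n) (by simp [ih])) s
      have : C (n + 1) ⊆ ⋃ y ∈ q, ball y s := by
        rw [← hq]; exact Set.inter_subset_right
      exact measure_mono_null this
        ((measure_biUnion_null_iff hqc).2 fun y hy => hW y (hCW n (hqC hy)))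
  refine measure_mono_null ?_ (measure_iUnion_null hC0)
  have hstep : ∀ y z : W, R y z → (y : X) ∈ ⋃ n, C n → (z : X) ∈ ⋃ n, C n := by
    intro y z hyz hy
    obtain ⟨n, hn⟩ := Set.mem_iUnion.1 hy
    refine Set.mem_iUnion_of_mem (n + 1) ⟨z.2, Set.mem_biUnion hn ?_⟩
    rw [mem_ball, dist_comm]
    exact hyz
  let p : Quot R → Prop := Quot.lift (fun y => (y : X) ∈ ⋃ n, C n) fun y z hyz =>
    propext ⟨hstep y z hyz, hstep z y (by simpa only [R, dist_comm] using hyz)⟩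
  rintro _ ⟨y, hy, rfl⟩
  have hxy : Quot.mk R y = Quot.mk R x := by
    rw [← Quot.out_eq (Quot.mk R y), ← Quot.out_eq (Quot.mk R x)]
    exact congrArg _ (Eq.trans hy (Eq.symm hx))
  have hpx : p (Quot.mk R x) := Set.mem_iUnion_of_mem 0 rfl
  rw [← hxy] at hpx
  exact hpx

variable {X : Type*} [MetricSpace X] [MeasurableSpace X] [BorelSpace X] {β : ℝ}
  {μ : Measure X} {T : X → X}

open scoped Classical in
lemma exists_isLocallyConstant_ae_constant [IsFiniteMeasure μ] (hT : MeasurePreserving T μ μ)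
    (hβ : 0 < β) {W : Set X} (hWc : IsClosed W) {s : ℝ} (hs : 0 < s)
    (hW : ∀ x ∈ W, μH[β] (ball x s) = 0) :
    ∃ L : W → W, IsLocallyConstant L ∧ (∀ d, μH[β] (((↑) : W → X) '' (L ⁻¹' {d})) = 0) ∧
      ∀ᵐ x ∂μ, ∀ m n (hm : T^[m] x ∈ W) (hn : T^[n] x ∈ W), L ⟨_, hm⟩ = L ⟨_, hn⟩ := by
  obtain ⟨L₀, hL₀, hnull⟩ := exists_isLocallyConstant_null_fibres hβ hs hW
  let L : X → Option W := fun x => if h : x ∈ W then some (L₀ ⟨x, h⟩) else none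
  have hLW : ∀ x (h : x ∈ W), L x = some (L₀ ⟨x, h⟩) := fun x h => dif_pos h
  have hLm : ∀ S : Set (Option W), MeasurableSet (L ⁻¹' S) := by
    intro S
    let _ : MeasurableSpace (Option W) := ⊤
    have : Measurable L := by
      refine Measurable.dite (f := fun x : W => some (L₀ x)) (g := fun _ => none) ?_
        measurable_const hWc.measurableSet
      exact fun S _ => (hL₀ (some ⁻¹' S)).measurableSet
    exact this trivial
  have hsep : ∀ d, TopologicalSpace.IsSeparable (L₀ ⁻¹' {d}) := fun d => by
    have h := (Topology.IsInducing.subtypeVal :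
      Topology.IsInducing ((↑) : W → X)).isSeparable_preimage
      (isSeparable_of_hausdorffMeasure_ne_top hβ (s := ((↑) : W → X) '' (L₀ ⁻¹' {d}))
        (by rw [hnull]; simp))
    rwa [Set.preimage_image_eq _ Subtype.val_injective] at h
  have : IsFiniteMeasure (μ.comap ((↑) : W → X)) := inferInstance
  choose F hFc hF using fun n : ℕ => exists_countable_fibrewise (μ.comap ((↑) : W → X)) hL₀ hsep
    (fun x => L (T^[n] x)) fun S =>
      measurable_subtype_coe ((hT.iterate n).measurable (hLm S))
  obtain ⟨ℓ, hℓ, hae⟩ := exists_ae_constant_merging hT hLm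
    (F := fun d => ⋃ n, some ⁻¹' F n d)
    (fun d => Set.countable_iUnion fun n => (hFc n d).preimage (Option.some_injective _)) (by
      have h := ae_all_iff.2 hF
      have h' : ∀ᵐ x ∂μ, ∀ hx : x ∈ W, ∀ n, L (T^[n] x) ∈ F n (L₀ ⟨x, hx⟩) := by
        filter_upwards [(ae_restrict_iff' hWc.measurableSet).1 ((ae_restrict_iff_subtype
          (p := fun x => ∀ hx : x ∈ W, ∀ n, L (T^[n] x) ∈ F n (L₀ ⟨x, hx⟩))
          hWc.measurableSet).2 (h.mono fun y hy _ => hy))] with x hx hxW using hx hxW hxW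
      filter_upwards [h'] with x hx n d e hd he
      have hxW : x ∈ W := by
        by_contra hn
        simp [L, hn] at hd
      rw [hLW x hxW, Option.some_inj] at hd
      have := hx hxW n
      rw [he, hd] at this
      exact Set.mem_iUnion_of_mem n this)
  refine ⟨fun x => ℓ (L₀ x), hL₀.comp ℓ, fun d => ?_, ?_⟩
  · have : ((↑) : W → X) '' ((fun x => ℓ (L₀ x)) ⁻¹' {d}) ⊆
        ⋃ e ∈ ℓ ⁻¹' {d}, ((↑) : W → X) '' (L₀ ⁻¹' {e}) := by
      rintro _ ⟨x, hx, rfl⟩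
      exact Set.mem_biUnion hx ⟨x, rfl, rfl⟩
    exact measure_mono_null this ((measure_biUnion_null_iff (hℓ d)).2 fun e _ => hnull e)
  · filter_upwards [hae] with x hx m n hm hn
    exact hx m n _ _ (hLW _ hm) (hLW _ hn)

open scoped Classical in
/-- Quick recurrence to sets whose points have Hausdorff-null balls of a fixed radius. -/
lemma ae_not_of_hausdorffMeasure_ball_eq_zero [IsFiniteMeasure μ] (hT : MeasurePreserving T μ μ)
    (hβ : 0 < β) {W : Set X} (hWc : IsClosed W) {s : ℝ} (hs : 0 < s)
    (hW : ∀ x ∈ W, μH[β] (ball x s) = 0) {c : ℝ≥0∞} (hc0 : c ≠ 0) (hc : c ≠ ∞) :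
    ∀ᵐ x ∂μ, x ∈ W → ¬ ∀ n ≠ 0, c ≤ n * edist (T^[n] x) x ^ β := by
  obtain ⟨L, hL, hnull, hae⟩ := exists_isLocallyConstant_ae_constant hT hβ hWc hs hW
  have hext : ∀ f : W → ℝ≥0∞, Measurable fun x => if h : x ∈ W then f (L ⟨x, h⟩) else 0 := by
    intro f
    refine Measurable.dite (f := fun x : W => f (L x)) (g := fun _ => 0) ?_
        measurable_const hWc.measurableSet
    exact (hL.comp f).continuous.measurable
  set B := {x ∈ W | ∀ n ≠ 0, c ≤ n * edist (T^[n] x) x ^ β}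
  suffices hB : c * μ B = 0 by
    filter_upwards [measure_eq_zero_iff_ae_notMem.1 ((mul_eq_zero.1 hB).resolve_left hc0)]
      with x hx hxW h
    exact hx ⟨hxW, h⟩
  refine eq_zero_of_forall_le_mul (measure_ne_top μ Set.univ) fun ε hε => ?_
  choose t ht _ htε using fun d => exists_cover_of_hausdorffMeasure_lt hβ
    (show μH[β] (((↑) : W → X) '' (L ⁻¹' {d})) < ε by rw [hnull]; exact hε) one_pos
  let a : ℕ → X → ℝ≥0∞ := fun i x => if h : x ∈ W then ediam (t (L ⟨x, h⟩) i) ^ β else 0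
  have ham : ∀ i, Measurable (a i) := fun i => hext fun d => ediam (t d i) ^ β
  have haW : ∀ i x (h : x ∈ W), a i x = ediam (t (L ⟨x, h⟩) i) ^ β := fun i x h => dif_pos h
  let U : ℕ → Set X := fun i => {x | ∃ h : x ∈ W, x ∈ closure (t (L ⟨x, h⟩) i)}
  have hU : ∀ i, MeasurableSet (U i) := by
    intro i
    have hcl : IsOpen {x : W | (x : X) ∉ closure (t (L x) i)} := by
      have : {x : W | (x : X) ∉ closure (t (L x) i)} =
          ⋃ d, L ⁻¹' {d} ∩ (↑) ⁻¹' (closure (t d i))ᶜ := by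
        ext x
        simp only [Set.mem_iUnion, Set.mem_inter_iff, Set.mem_preimage, Set.mem_singleton_iff,
          Set.mem_compl_iff, exists_eq_left', Set.mem_ofPred_eq]
      rw [this]
      exact isOpen_iUnion fun d =>
        (hL {d}).inter (isClosed_closure.isOpen_compl.preimage continuous_subtype_val)
    have : U i = ((↑) : W → X) '' {x : W | (x : X) ∉ closure (t (L x) i)}ᶜ := by
      ext x
      constructor
      · rintro ⟨hx, hx'⟩
        exact ⟨⟨x, hx⟩, not_not.2 hx', rfl⟩
      · rintro ⟨y, hy, rfl⟩
        exact ⟨y.2, not_not.1 hy⟩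
    rw [this]
    exact (MeasurableEmbedding.subtype_coe hWc.measurableSet).measurableSet_image.2
      hcl.measurableSet.compl
  let V : ℕ → Set X := fun i => U i ∩ ⋂ (n : ℕ) (_ : n ≠ 0), {x | c ≤ n * a i x} ∪ T^[n] ⁻¹' (U i)ᶜ
  have hV : ∀ i, MeasurableSet (V i) := fun i =>
    (hU i).inter (MeasurableSet.iInter fun n => MeasurableSet.iInter fun _ =>
      (measurableSet_le measurable_const ((ham i).const_mul _)).union
        ((hT.iterate n).measurable (hU i).compl))
  let g : ℕ → X → ℝ≥0∞ := fun i x => ⨆ n, a i (T^[n] x)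
  have hgm : ∀ i, Measurable (g i) := fun i =>
    Measurable.iSup fun n => (ham i).comp (hT.iterate n).measurable
  have hVg : ∀ i, c * μ (V i) ≤ ∫⁻ x, g i x ∂μ := by
    intro i
    refine mul_measure_le_lintegral_of_separated_visits hT (hV i) hc (hgm i)
      (ae_of_all _ fun x j k hjk hj hk => ?_)
    have hk' : T^[k] x = T^[k - j] (T^[j] x) := by
      rw [← Function.iterate_add_apply, Nat.sub_add_cancel hjk.le]
    have := Set.mem_iInter₂.1 hj.2 (k - j) (by omega)
    rcases this with h | h
    · refine le_trans h ?_
      gcongr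
      exact le_iSup (fun n => a i (T^[n] x)) j
    · exact absurd (hk' ▸ hk.1) h
  have hgε : ∀ᵐ x ∂μ, ∑' i, g i x ≤ ε := by
    filter_upwards [hae] with x hx
    by_cases h : ∃ n, T^[n] x ∈ W
    · obtain ⟨n, hn⟩ := h
      refine le_trans (ENNReal.tsum_le_tsum fun i => ?_) (htε (L ⟨_, hn⟩)).le
      refine iSup_le fun m => ?_
      by_cases hm : T^[m] x ∈ W
      · rw [haW i _ hm, hx m n hm hn]
      · simp [a, hm]
    · push Not at h
      simp [g, a, h]
  have hBV : ∀ᵐ x ∂μ, x ∈ B → x ∈ ⋃ i, V i := by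
    filter_upwards [hae] with x hx hxB
    obtain ⟨i, hi⟩ := Set.mem_iUnion.1 (ht (L ⟨x, hxB.1⟩) ⟨⟨x, hxB.1⟩, rfl, rfl⟩)
    refine Set.mem_iUnion_of_mem i ⟨⟨hxB.1, subset_closure hi⟩, Set.mem_iInter₂.2 fun n hn => ?_⟩
    by_cases hnU : T^[n] x ∈ U i
    · left
      obtain ⟨hnW, hn'⟩ := hnU
      rw [← hx 0 n hxB.1 hnW] at hn'
      refine (hxB.2 n hn).trans ?_
      rw [haW i x hxB.1]
      gcongr
      rw [← ediam_closure]
      exact edist_le_ediam_of_mem hn' (subset_closure hi)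
    · exact Or.inr hnU
  calc c * μ B ≤ c * ∑' i, μ (V i) := by
        gcongr
        exact (measure_mono_ae hBV).trans (measure_iUnion_le _)
    _ = ∑' i, c * μ (V i) := ENNReal.tsum_mul_left.symm
    _ ≤ ∑' i, ∫⁻ x, g i x ∂μ := ENNReal.tsum_le_tsum hVg
    _ = ∫⁻ x, ∑' i, g i x ∂μ := (lintegral_tsum fun i => (hgm i).aemeasurable).symm
    _ ≤ ∫⁻ _, ε ∂μ := lintegral_mono_ae hgε
    _ = ε * μ Set.univ := lintegral_const _

end NullBalls

section Main

lemma isClosed_setOf_measure_ball_eq_zero {X : Type*} [MetricSpace X] [MeasurableSpace X]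
    (μ : Measure X) (s : ℝ) : IsClosed {x | μ (ball x s) = 0} := by
  refine IsSeqClosed.isClosed fun u x hu hux => ?_
  refine measure_mono_null (fun y hy => ?_) (measure_iUnion_null hu)
  obtain ⟨n, hn⟩ := ((tendsto_const_nhds.dist hux).eventually_lt_const (mem_ball.1 hy)).exists
  exact Set.mem_iUnion_of_mem n hn

lemma exists_nat_forall_inv_le {X : Type*} [MetricSpace X] {T : X → X} {β : ℝ} (hβ : 0 < β)
    {c : ℝ≥0∞} (hc : c ≠ 0) {x : X} (h : ∀ᶠ n : ℕ in atTop, c < n * edist (T^[n] x) x ^ β) :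
    ∃ m : ℕ, ∀ n ≠ 0, ((m + 1 : ℕ) : ℝ≥0∞)⁻¹ ≤ n * edist (T^[n] x) x ^ β := by
  obtain ⟨N, hN⟩ := eventually_atTop.1 h
  have ht : Tendsto (fun m : ℕ => ((m + 1 : ℕ) : ℝ≥0∞)⁻¹) atTop (𝓝 0) :=
    ENNReal.tendsto_inv_nat_nhds_zero.comp (tendsto_add_atTop_nat 1)
  have h1 : ∀ᶠ m : ℕ in atTop, ∀ n ∈ Finset.range N, n ≠ 0 →
      ((m + 1 : ℕ) : ℝ≥0∞)⁻¹ < n * edist (T^[n] x) x ^ β := by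
    rw [eventually_all_finset]
    intro n _
    rcases eq_or_ne n 0 with rfl | hn
    · simp
    · have hpos : 0 < (n : ℝ≥0∞) * edist (T^[n] x) x ^ β :=
        ENNReal.mul_pos (by exact_mod_cast hn) (ENNReal.rpow_pos
          (edist_pos.2 (iterate_ne_of_eventually_lt hβ h hn)) (edist_ne_top _ _)).ne'
      filter_upwards [ht.eventually_lt_const hpos] with m hm _ using hm
  obtain ⟨m, hm1, hm2⟩ := (h1.and (ht.eventually_lt_const (pos_iff_ne_zero.2 hc))).exists
  refine ⟨m, fun n hn => ?_⟩
  rcases lt_or_ge n N with hnN | hnN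
  · exact (hm1 n (Finset.mem_range.2 hnN) hn).le
  · exact (hm2.trans (hN n hnN)).le

end Main

/-- **Recurrence vs. Hausdorff density.** If `μ` is a Borel probability measure on a metric
space `X` and `T : X → X` is measurable and preserves `μ`, then for every `β > 0`, for
`μ`-a.e. `x`, `liminf_n n d(T^n x, x)^β ≤ limsup_{r→0} H_β(B(x,r))/μ(B(x,r))`. -/
theorem recurrence_hausdorff_density {X : Type*} [MetricSpace X] [MeasurableSpace X]
    [BorelSpace X] (μ : Measure X) [IsProbabilityMeasure μ] (T : X → X)
    (hT : Measurable T) (hinv : ∀ A : Set X, MeasurableSet A → μ (T ⁻¹' A) = μ A)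
    (β : ℝ) (hβ : 0 < β) :
    ∀ᵐ x ∂μ,
      Filter.liminf (fun n : ℕ => (n : ℝ≥0∞) * ENNReal.ofReal (dist (T^[n] x) x ^ β))
          Filter.atTop
        ≤ Filter.limsup (fun r : ℝ => μH[β] (ball x r) / μ (ball x r)) (𝓝[>] 0) := by
  have hTμ : MeasurePreserving T μ μ :=
    ⟨hT, Measure.ext fun A hA => by rw [Measure.map_apply hT hA, hinv A hA]⟩
  set Z := closure {x : X | ∀ r > 0, 0 < μ (ball x r)} with hZ
  have hsep : ∀ p q : ℚ, ∀ᵐ x ∂μ,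
      ((Real.toNNReal p : ℝ≥0) : ℝ≥0∞) < (Real.toNNReal q : ℝ≥0) → x ∈ Z →
      (∀ᶠ n : ℕ in atTop, ((Real.toNNReal q : ℝ≥0) : ℝ≥0∞) < n * edist (T^[n] x) x ^ β) →
      ¬ ∀ᶠ r in 𝓝[>] (0 : ℝ), μH[β] (ball x r) ≤ (Real.toNNReal p : ℝ≥0) * μ (ball x r) :=
    fun p q => eventually_imp_distrib_left.2 fun hpq => ae_not_of_isSeparable hTμ hβ
      isClosed_closure (isSeparable_setOf_forall_measure_ball_pos μ).closure ENNReal.coe_ne_top hpq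
  have hnull : ∀ k m : ℕ, ∀ᵐ x ∂μ, μH[β] (ball x (1 / ((k : ℝ) + 1))) = 0 →
      ¬ ∀ n ≠ 0, ((m + 1 : ℕ) : ℝ≥0∞)⁻¹ ≤ n * edist (T^[n] x) x ^ β := fun k m =>
    ae_not_of_hausdorffMeasure_ball_eq_zero hTμ hβ
      (isClosed_setOf_measure_ball_eq_zero μH[β] (1 / ((k : ℝ) + 1))) (by positivity)
      (fun _ h => h) (ENNReal.inv_ne_zero.2 (ENNReal.natCast_ne_top _))
      (ENNReal.inv_ne_top.2 (by simp))
  filter_upwards [ae_all_iff.2 fun p => ae_all_iff.2 (hsep p),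
    ae_all_iff.2 fun k => ae_all_iff.2 (hnull k)] with x hx hx'
  by_contra! hlt
  obtain ⟨q, -, hq, hqlim⟩ := ENNReal.lt_iff_exists_rat_btwn.1 hlt
  obtain ⟨p, -, hp, hpq⟩ := ENNReal.lt_iff_exists_rat_btwn.1 hq
  have hret : ∀ᶠ n : ℕ in atTop,
      ((Real.toNNReal q : ℝ≥0) : ℝ≥0∞) < n * edist (T^[n] x) x ^ β := by
    filter_upwards [eventually_lt_of_lt_liminf hqlim] with n hn
    rwa [edist_dist, ENNReal.ofReal_rpow_of_nonneg dist_nonneg hβ.le]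
  have hden : ∀ᶠ r in 𝓝[>] (0 : ℝ),
      μH[β] (ball x r) ≤ (Real.toNNReal p : ℝ≥0) * μ (ball x r) := by
    filter_upwards [eventually_lt_of_limsup_lt hp] with r hr
    exact (ENNReal.div_le_iff_le_mul (Or.inr ENNReal.coe_ne_top)
      (Or.inl (measure_ne_top _ _))).1 hr.le
  by_cases hxZ : x ∈ Z
  · exact hx p q hpq hxZ hret hden
  · have hxZ' : ¬ ∀ r > 0, 0 < μ (ball x r) := fun h => hxZ (subset_closure h)
    push Not at hxZ'
    obtain ⟨r₁, hr₁, hr₁0⟩ := hxZ'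
    obtain ⟨u, hu, hur⟩ := mem_nhdsGT_iff_exists_Ioo_subset.1 hden
    obtain ⟨k, hk⟩ := exists_nat_one_div_lt (lt_min hr₁ (Set.mem_Ioi.1 hu))
    obtain ⟨m, hm⟩ := exists_nat_forall_inv_le hβ (bot_le.trans_lt hpq).ne' hret
    refine hx' k m (le_antisymm ?_ bot_le) hm
    have h0 : μ (ball x (1 / ((k : ℝ) + 1))) = 0 :=
      measure_mono_null (ball_subset_ball (hk.le.trans (min_le_left _ _)))
        (le_antisymm hr₁0 bot_le)
    have h1 : (1 / ((k : ℝ) + 1)) ∈ Set.Ioo 0 u :=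
      ⟨by positivity, hk.trans_le (min_le_right _ _)⟩
    have h2 : μH[β] (ball x (1 / ((k : ℝ) + 1))) ≤
      (Real.toNNReal p : ℝ≥0) * μ (ball x (1 / ((k : ℝ) + 1))) := hur h1
    rwa [h0, mul_zero] at h2
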